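/- arXiv:1501.03602 — 2 statements merged into one kernel-verified Lean document; each statement's English description precedes it below -/
import Mathlib

section
/- Let x and y be words over an alphabet A, and let α = x·w and β = y·w' where w, w' are arbitrary products of copies of x and y (i.e., α ∈ x{x,y}* and β ∈ y{x,y}*). If α and β have a common prefix of length at least |x| + |y|, then x and y commute. -/
namespace FreeMonoid

variable {A : Type*}

/-- Of two left factors of the same word, the shorter is a left factor of the longer. -/
theorem exists_eq_mul_of_mul_eq_mul {a b c d : FreeMonoid A} (h : a * b = c * d)
    (hl : a.length ≤ c.length) : ∃ e, c = a * e := by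
  obtain ⟨e, he⟩ : a.toList <+: c.toList :=
    List.prefix_of_prefix_length_le (l₃ := (a * b).toList) ⟨b.toList, rfl⟩
      ⟨d.toList, (congrArg toList h).symm⟩ hl
  exact ⟨ofList e, toList.injective he.symm⟩

theorem closure_pair_mul_le (x z : FreeMonoid A) :
    Submonoid.closure {x, x * z} ≤ Submonoid.closure {x, z} := by
  have hx : x ∈ Submonoid.closure {x, z} := Submonoid.subset_closure (by simp)
  have hz : z ∈ Submonoid.closure {x, z} := Submonoid.subset_closure (by simp)
  rw [Submonoid.closure_le]
  rintro _ (rfl | rfl)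
  exacts [hx, mul_mem hx hz]

theorem eq_one_or_exists_eq_mul_of_mem_closure {x z w : FreeMonoid A}
    (hw : w ∈ Submonoid.closure {x, x * z}) :
    w = 1 ∨ ∃ u ∈ Submonoid.closure {x, z}, w = x * u := by
  induction hw using Submonoid.closure_induction with
  | mem a ha =>
    rcases ha with rfl | rfl
    · exact Or.inr ⟨1, one_mem _, (mul_one _).symm⟩
    · exact Or.inr ⟨z, Submonoid.subset_closure (by simp), rfl⟩
  | one => exact Or.inl rfl
  | mul a b _ hb iha ihb =>
    rcases iha with rfl | ⟨u, hu, rfl⟩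
    · simpa using ihb
    · exact Or.inr ⟨u * b, mul_mem hu (closure_pair_mul_le x z hb), mul_assoc _ _ _⟩

theorem mul_comm_of_long_common_prefix (n : ℕ) (x y w w' p s s' : FreeMonoid A)
    (hn : x.length + y.length ≤ n)
    (hw : w ∈ Submonoid.closure {x, y}) (hw' : w' ∈ Submonoid.closure {x, y})
    (hlen : x.length + y.length ≤ p.length)
    (h : x * w = p * s) (h' : y * w' = p * s') : x * y = y * x := by
  induction n generalizing x y w w' p s s' with
  | zero =>
    have hx : x = 1 := length_eq_zero.1 (by omega)
    simp [hx]
  | succ n ih =>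
    wlog hxy : x.length ≤ y.length generalizing x y w w' s s'
    · exact (this y x w' w s' s (by omega) (Set.pair_comm x y ▸ hw')
        (Set.pair_comm x y ▸ hw) (by omega) h' h (by omega)).symm
    rcases eq_or_ne x 1 with rfl | hx
    · simp
    have hx0 : x.length ≠ 0 := fun h0 => hx (length_eq_zero.1 h0)
    obtain ⟨p, rfl⟩ := exists_eq_mul_of_mul_eq_mul h (by omega)
    obtain ⟨q, hq⟩ := exists_eq_mul_of_mul_eq_mul h' (by omega)
    obtain ⟨z, rfl⟩ := exists_eq_mul_of_mul_eq_mul hq hxy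
    simp only [mul_assoc, mul_right_inj, length_mul] at h h' hn hlen
    suffices hxz : x * z = z * x by rw [mul_assoc, ← hxz]
    rcases eq_one_or_exists_eq_mul_of_mem_closure hw with rfl | ⟨u, hu, rfl⟩
    · have := congrArg length h
      simp only [length_mul, length_one] at this
      omega
    · exact ih x z u w' p s s' (by omega) hu (closure_pair_mul_le x z hw') (by omega) h h'

end FreeMonoid


/-- If `α ∈ x{x,y}*` and `β ∈ y{x,y}*` have a common prefix of length at least
`|x| + |y|`, then `x` and `y` commute. -/
theorem stmt1 {A : Type*} (x y α β p : FreeMonoid A)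
    (hα : ∃ w ∈ Submonoid.closure ({x, y} : Set (FreeMonoid A)), α = x * w)
    (hβ : ∃ w ∈ Submonoid.closure ({x, y} : Set (FreeMonoid A)), β = y * w)
    (hlen : x.length + y.length ≤ p.length)
    (hpα : ∃ s, α = p * s) (hpβ : ∃ s, β = p * s) :
    x * y = y * x := by
  obtain ⟨w, hw, rfl⟩ := hα
  obtain ⟨w', hw', rfl⟩ := hβ
  obtain ⟨s, hs⟩ := hpα
  obtain ⟨s', hs'⟩ := hpβ
  exact FreeMonoid.mul_comm_of_long_common_prefix _ x y w w' p s s' le_rfl hw hw' hlen hs hs'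
end

section
/- Let x and y be words over an alphabet A that do not commute (xy ≠ yx). Then the set {x y^n : n ≥ 1} ∪ {x^n y : n ≥ 1} contains at most one imprimitive word; that is, there is at most one word in this set that can be written as z^m for some word z and some integer m ≥ 2. -/
/-- A word is imprimitive if it is a proper power. -/
def IsImprimitiveWord {A : Type*} (w : FreeMonoid A) : Prop :=
  ∃ (z : FreeMonoid A) (m : ℕ), 2 ≤ m ∧ w = z ^ m

namespace FreeMonoid

variable {A : Type*}

theorem length_pow (u : FreeMonoid A) (n : ℕ) : (u ^ n).length = n * u.length := by
  induction n with
  | zero => simp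
  | succ n ih => rw [pow_succ, length_mul, ih]; ring

/-- Levi's lemma: of two prefixes of a word, the shorter one is a prefix of the longer one. -/
theorem exists_eq_mul_of_mul_eq_mul_s5 {u v u' v' : FreeMonoid A} (h : u * v = u' * v')
    (hl : u.length ≤ u'.length) : ∃ c, u' = u * c ∧ v = c * v' := by
  rcases List.append_eq_append_iff.1 (show u.toList ++ v.toList = u'.toList ++ v'.toList from h) with
    ⟨c, h₁, h₂⟩ | ⟨c, h₁, h₂⟩
  · exact ⟨ofList c, h₁, h₂⟩
  · have h₁' : u = u' * ofList c := h₁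
    have h₂' : v' = ofList c * v := h₂
    have hc : (ofList c).length = 0 := by
      have := congrArg length h₁'
      rw [length_mul] at this
      omega
    rw [length_eq_zero] at hc
    rw [hc] at h₁' h₂'
    exact ⟨1, by simp [h₁'], by simp [h₂']⟩

theorem eq_of_mul_eq_mul_of_length_eq {u v u' v' : FreeMonoid A} (h : u * v = u' * v')
    (hl : u.length = u'.length) : u = u' ∧ v = v' := by
  obtain ⟨c, h₁, h₂⟩ := exists_eq_mul_of_mul_eq_mul_s5 h hl.le
  have hc : c.length = 0 := by
    have := congrArg length h₁
    rw [length_mul] at this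
    omega
  rw [length_eq_zero] at hc
  simp_all

/-- A weak form of the Fine–Wilf theorem: if `w` is a prefix of both `u * w` and `v * w` and is
at least as long as `u * v`, then `u` and `v` commute. -/
theorem commute_of_periods {u v w c d : FreeMonoid A} (hu : u * w = w * c) (hv : v * w = w * d)
    (hl : u.length + v.length ≤ w.length) : Commute u v := by
  obtain ⟨u₁, hu₁, -⟩ := exists_eq_mul_of_mul_eq_mul_s5 hu (by omega)
  obtain ⟨v₁, hv₁, -⟩ := exists_eq_mul_of_mul_eq_mul_s5 hv (by omega)
  have h₁ : (u * v) * v₁ = w * c := by rw [mul_assoc, ← hv₁, hu]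
  have h₂ : (v * u) * u₁ = w * d := by rw [mul_assoc, ← hu₁, hv]
  obtain ⟨e, he, -⟩ := exists_eq_mul_of_mul_eq_mul_s5 h₁ (by rwa [length_mul])
  obtain ⟨f, hf, -⟩ := exists_eq_mul_of_mul_eq_mul_s5 h₂ (by rw [length_mul]; omega)
  exact (eq_of_mul_eq_mul_of_length_eq (he.symm.trans hf) (by simp [add_comm])).1

/-- A prefix of a power of `t` is a prefix of its own shift by `t`. -/
theorem exists_mul_eq_mul_of_prefix_pow {t w r : FreeMonoid A} {b : ℕ} (h : w * r = t ^ b) :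
    ∃ c, t * w = w * c := by
  have : w * (r * t) = (t * w) * r := by
    rw [← mul_assoc, mul_assoc t, h, ← pow_succ, ← pow_succ']
  obtain ⟨c, hc, -⟩ := exists_eq_mul_of_mul_eq_mul_s5 this (by rw [length_mul]; omega)
  exact ⟨c, hc⟩

theorem commute_of_commute_mul_right {z u v : FreeMonoid A} (h : Commute z (u * v))
    (hu : Commute z u) : Commute z v := by
  have h₁ : z * (u * v) = (u * v) * z := h
  rw [← mul_assoc, hu.eq, mul_assoc, mul_assoc] at h₁
  exact mul_left_cancel h₁

theorem commute_of_pow_commute {u v : FreeMonoid A} {n : ℕ} (hn : n ≠ 0)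
    (h : Commute (u ^ n) v) : Commute u v := by
  rcases Nat.eq_zero_or_pos u.length with hu | hu
  · rw [length_eq_zero] at hu
    rw [hu]
    exact Commute.one_left v
  · have h₁ : Commute u ((u ^ n) ^ (v.length + 1)) :=
      ((Commute.refl u).pow_right n).pow_right _
    have h₂ : Commute v ((u ^ n) ^ (v.length + 1)) := h.symm.pow_right _
    refine commute_of_periods h₁.eq h₂.eq ?_
    rw [length_pow, length_pow]
    have : 1 ≤ n := Nat.one_le_iff_ne_zero.2 hn
    calc u.length + v.length ≤ (v.length + 1) * (1 * u.length) := by nlinarith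
      _ ≤ _ := by gcongr

/-- A conjugate of a power is a power with the same exponent. -/
theorem exists_mul_eq_pow_of_mul_eq_pow {u v t : FreeMonoid A} {b : ℕ} (h : u * v = t ^ b) :
    ∃ t' : FreeMonoid A, v * u = t' ^ b := by
  induction u using FreeMonoid.inductionOn' generalizing v t with
  | one => exact ⟨t, by simpa using h⟩
  | of_mul a u ih =>
    rcases b with _ | b
    · have := congrArg length h
      simp at this
    · have ht : 1 ≤ t.length := by
        by_contra hlt
        have ht : t.length = 0 := by omega
        rw [length_eq_zero] at ht
        have := congrArg length h
        simp [ht] at this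
      obtain ⟨s, rfl, -⟩ := exists_eq_mul_of_mul_eq_mul_s5
        (show of a * (u * v) = t * t ^ b by rw [← mul_assoc, h, pow_succ']) (by simpa using ht)
      have h' : u * (v * of a) = (s * of a) ^ (b + 1) := by
        apply mul_left_cancel (a := of a)
        rw [← mul_pow_mul, ← h]
        simp only [mul_assoc]
      obtain ⟨t', ht'⟩ := ih h'
      exact ⟨t', by rw [← ht', mul_assoc]⟩

theorem commute_of_pow_mul_eq_pow_of_le {z w t : FreeMonoid A} {a b : ℕ}
    (h : z ^ a * w = t ^ b) (hl : z.length + t.length ≤ a * z.length) : Commute z w := by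
  obtain ⟨c, hc⟩ := exists_mul_eq_mul_of_prefix_pow h
  have hz : Commute z (z ^ a) := (Commute.refl z).pow_right a
  have hzt : Commute z t := commute_of_periods hz.eq hc (by rwa [length_pow])
  exact commute_of_commute_mul_right (h ▸ hzt.pow_right b) hz

/-- The case of a square and a cube in the Lyndon–Schützenberger theorem. -/
theorem commute_of_sq_mul_pow_eq_cube {z y t : FreeMonoid A} {k : ℕ} (hk : 2 ≤ k)
    (h : z ^ 2 * y ^ k = t ^ 3) (hle : k * y.length ≤ 2 * z.length)
    (hzt : z.length < t.length) (hyt : k * y.length < y.length + t.length) : Commute z y := by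
  have hlen := congrArg length h
  simp only [length_mul, length_pow] at hlen
  obtain ⟨s, rfl, hs⟩ := exists_eq_mul_of_mul_eq_mul_s5
    (show z * (z * y ^ k) = t * (t * t) by
      rw [← mul_assoc, ← sq, h, pow_succ', sq]) hzt.le
  rw [length_mul] at *
  obtain ⟨s', hs', hy⟩ := exists_eq_mul_of_mul_eq_mul_s5
    (show z * y ^ k = (s * z) * (s * (z * s)) by rw [hs]; simp only [mul_assoc])
    (by rw [length_mul]; omega)
  have hls : s'.length = s.length := by
    have := congrArg length hs'
    simp only [length_mul] at this
    omega
  obtain ⟨k, rfl⟩ := Nat.exists_eq_add_of_le' hk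
  have hyk : (k + 2) * y.length = k * y.length + 2 * y.length := by ring
  obtain ⟨c, hc, hzs⟩ := exists_eq_mul_of_mul_eq_mul_s5
    (show (s' * s) * (z * s) = y * y ^ (k + 1) by rw [← pow_succ', hy]; simp only [mul_assoc])
    (by rw [length_mul]; omega)
  have hlc := congrArg length hc
  simp only [length_mul] at hlc
  obtain ⟨d, hd, -⟩ := exists_eq_mul_of_mul_eq_mul_s5
    (show (c * (s' * s)) * (c * y ^ k) = z * s by
      rw [mul_assoc, ← mul_assoc _ c, ← hc, hzs, pow_succ'])
    (by simp only [length_mul]; omega)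
  have hsz : s = s' := by
    have h₁ : (s * c) * (s' * (s * d)) = (c * s') * (s * (d * s')) := by
      calc _ = s * z := by rw [hd]; simp only [mul_assoc]
        _ = _ := by rw [hs', hd]; simp only [mul_assoc]
    have h₂ := (eq_of_mul_eq_mul_of_length_eq h₁ (by simp only [length_mul]; omega)).2
    exact (eq_of_mul_eq_mul_of_length_eq h₂ hls).1.symm
  have hcomm : Commute z s := by rw [← hsz] at hs'; exact hs'.symm
  have hzt' : Commute z ((z * s) ^ 3) := ((Commute.refl z).mul_right hcomm).pow_right 3
  rw [← h] at hzt'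
  exact (commute_of_pow_commute (by omega)
    (commute_of_commute_mul_right hzt' ((Commute.refl z).pow_right 2)).symm).symm

/-- The Lyndon–Schützenberger theorem. -/
theorem commute_of_pow_mul_pow_eq_pow {z y t : FreeMonoid A} {a k b : ℕ} (ha : 2 ≤ a)
    (hk : 2 ≤ k) (hb : 2 ≤ b) (h : z ^ a * y ^ k = t ^ b) : Commute z y := by
  induction hn : b * t.length using Nat.strong_induction_on generalizing z y t a k b with
  | _ n ih =>
  wlog hle : k * y.length ≤ a * z.length generalizing z y t a k
  · obtain ⟨t', ht'⟩ := exists_mul_eq_pow_of_mul_eq_pow h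
    refine (this hk ha ht' ?_ (by omega)).symm
    have h₁ := congrArg length h
    have h₂ := congrArg length ht'
    simp only [length_mul, length_pow] at h₁ h₂
    omega
  have hlen := congrArg length h
  simp only [length_mul, length_pow] at hlen
  rcases Nat.eq_zero_or_pos y.length with hy | hy
  · rw [length_eq_zero] at hy
    rw [hy]
    exact Commute.one_right z
  by_cases hz : z.length + t.length ≤ a * z.length
  · exact (commute_of_pow_commute (by omega) (commute_of_pow_mul_eq_pow_of_le h hz).symm).symm
  by_cases hyt : y.length + t.length ≤ k * y.length
  · obtain ⟨t', ht'⟩ := exists_mul_eq_pow_of_mul_eq_pow h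
    have hl : t'.length = t.length := by
      have := congrArg length ht'
      simp only [length_mul, length_pow] at this
      exact Nat.eq_of_mul_eq_mul_left (by omega : 0 < b) (by omega)
    exact commute_of_pow_commute (by omega)
      (commute_of_pow_mul_eq_pow_of_le ht' (hl ▸ hyt)).symm
  push Not at hz hyt
  rcases hb.eq_or_lt with rfl | hb
  · obtain ⟨c, hc, htc⟩ := exists_eq_mul_of_mul_eq_mul_s5
      (show t * t = z ^ a * y ^ k by rw [h, sq]) (by rw [length_pow]; omega)
    have hz' : c * (y ^ k * c) = z ^ a := by rw [hc, ← mul_assoc, ← htc]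
    obtain ⟨z', hz''⟩ := exists_mul_eq_pow_of_mul_eq_pow hz'
    have hl : a * z'.length = a * z.length := by
      have h₁ := congrArg length hz''
      have h₂ := congrArg length hz'
      simp only [length_mul, length_pow] at h₁ h₂
      omega
    have hyk : 0 < k * y.length := Nat.mul_pos (by omega) hy
    have hyc : Commute y c :=
      ih _ (by omega) hk le_rfl ha (show y ^ k * c ^ 2 = z' ^ a by
        rw [← hz'', sq, mul_assoc]) rfl
    have : Commute y (z ^ a) := by
      rw [← hz']
      exact hyc.mul_right (((Commute.refl y).pow_right k).mul_right hyc)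
    exact commute_of_pow_commute (by omega) this.symm
  · obtain rfl : a = 2 := by
      by_contra hne
      have : 3 ≤ a := by omega
      have h₁ : 3 * t.length ≤ b * t.length := by gcongr; omega
      have h₂ : 3 * z.length ≤ a * z.length := by gcongr
      omega
    obtain rfl : b = 3 := by
      by_contra hne
      have h₁ : 4 * t.length ≤ b * t.length := by gcongr; omega
      omega
    exact commute_of_sq_mul_pow_eq_cube hk h hle (by omega) hyt

theorem commute_of_isImprimitiveWord_mul_pow {x y : FreeMonoid A} {i k : ℕ} (hi : 1 ≤ i)
    (hk : 1 ≤ k) (h₁ : IsImprimitiveWord (x * y ^ i))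
    (h₂ : IsImprimitiveWord (x * y ^ (i + k))) : Commute x y := by
  obtain ⟨z, a, ha, hz⟩ := h₁
  obtain ⟨t, b, hb, ht⟩ := h₂
  have commute_of_commute_pow {z : FreeMonoid A} (hz : y ^ i * x = z ^ a) (hzy : Commute z y) :
      Commute x y :=
    (commute_of_commute_mul_right (hz ▸ hzy.symm.pow_right a)
      ((Commute.refl y).pow_right i)).symm
  rcases hk.eq_or_lt with rfl | hk
  · obtain ⟨z, hz⟩ := exists_mul_eq_pow_of_mul_eq_pow hz
    rw [pow_succ', ← mul_assoc] at ht
    obtain ⟨t, ht⟩ := exists_mul_eq_pow_of_mul_eq_pow ht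
    rw [← mul_assoc] at ht
    have hlz := congrArg length hz
    have hlt := congrArg length ht
    simp only [length_mul, length_pow] at hlz hlt
    obtain ⟨c, hc⟩ := exists_mul_eq_mul_of_prefix_pow
      (show y * (y ^ (i - 1) * x) = z ^ a by
        rw [← mul_assoc, ← pow_succ', Nat.sub_add_cancel hi, hz])
    have hperz : z * (z ^ a * y) = (z ^ a * y) * c := by
      rw [← mul_assoc, ← pow_succ', pow_succ, mul_assoc, hc, mul_assoc]
    have hw : z ^ a * y = t ^ b := by rw [← ht, ← hz]
    have hpert : t * (z ^ a * y) = (z ^ a * y) * t := by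
      rw [hw, ← pow_succ, ← pow_succ']
    have hzt : Commute z t := by
      refine commute_of_periods hperz hpert ?_
      rw [hw, length_pow]
      have h₁ : 2 * z.length ≤ a * z.length := by gcongr
      have h₂ : 2 * t.length ≤ b * t.length := by gcongr
      have h₃ := congrArg length hw
      simp only [length_mul, length_pow] at h₃
      omega
    exact commute_of_commute_pow hz (commute_of_commute_mul_right (hw ▸ hzt.pow_right b)
      ((Commute.refl z).pow_right a))
  · have hzy : Commute z y := commute_of_pow_mul_pow_eq_pow ha hk hb
      (show z ^ a * y ^ k = t ^ b by rw [← hz, ← ht, pow_add, mul_assoc])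
    have hx : Commute y (x * y ^ i) := hz ▸ hzy.symm.pow_right a
    have : y * x * y ^ i = x * y * y ^ i := by
      have := hx.eq
      rw [mul_assoc x, ← pow_succ, pow_succ'] at this
      simpa only [mul_assoc] using this
    exact (mul_right_cancel this).symm

theorem commute_of_isImprimitiveWord_of_length_le {x y : FreeMonoid A} {i j : ℕ} (hi : 2 ≤ i)
    (hj : 2 ≤ j) (hyx : y.length ≤ x.length) (h₁ : IsImprimitiveWord (x * y ^ i))
    (h₂ : IsImprimitiveWord (x ^ j * y)) : Commute x y := by
  obtain ⟨z, a, ha, hz⟩ := h₁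
  obtain ⟨t, b, hb, ht⟩ := h₂
  by_cases hxt : x.length + t.length ≤ j * x.length
  · exact commute_of_pow_mul_eq_pow_of_le ht hxt
  have hlt := congrArg length ht
  simp only [length_mul, length_pow] at hlt
  have hbt : 2 * t.length ≤ b * t.length := by gcongr
  obtain rfl : j = 2 := by
    by_contra hne
    have h₁ : 3 * x.length ≤ j * x.length := by gcongr; omega
    omega
  obtain rfl : b = 2 := by
    by_contra hne
    have h₁ : 3 * t.length ≤ b * t.length := by gcongr; omega
    omega
  obtain ⟨p, rfl, hp⟩ := exists_eq_mul_of_mul_eq_mul_s5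
    (show x * (x * y) = t * t by rw [← mul_assoc, ← sq, ht, sq]) (by omega)
  obtain ⟨q, hq, rfl⟩ := exists_eq_mul_of_mul_eq_mul_s5
    (show x * y = (p * x) * p by rw [hp, mul_assoc]) (by rw [length_mul]; omega)
  have hlq : q.length = p.length := by
    have := congrArg length hq
    simp only [length_mul] at this
    omega
  suffices hpq : p = q by
    subst hpq
    have : Commute x p := hq.symm
    exact this.mul_right this
  obtain ⟨m, rfl⟩ : ∃ m, i = m + 1 := ⟨i - 1, by omega⟩
  have hlz := congrArg length hz
  simp only [length_mul, length_pow, hlq] at hlz hyx hlt hxt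
  have hlz' {z' : FreeMonoid A} (h : a * z'.length = a * z.length) : z'.length = z.length :=
    Nat.eq_of_mul_eq_mul_left (by omega) h
  by_cases hyz : z.length + 2 * p.length ≤ (m + 1) * (2 * p.length)
  · obtain ⟨z', hz'⟩ := exists_mul_eq_pow_of_mul_eq_pow hz
    have hl : z'.length = z.length := hlz' (by
      have := congrArg length hz'
      simp only [length_mul, length_pow, hlq] at this
      rw [← hlz, ← this, add_comm])
    have hqpx : Commute (q * p) x := commute_of_pow_mul_eq_pow_of_le hz' (by
      rw [length_mul, hl, hlq, ← two_mul]
      omega)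
    have h₁ : (q * x) * q = (x * q) * p := by
      rw [mul_assoc, ← hq, ← mul_assoc, hqpx.eq, mul_assoc, hp]
    exact (eq_of_mul_eq_mul_of_length_eq h₁ (by simp only [length_mul]; omega)).2.symm
  by_cases hpz : z.length ≤ p.length + x.length
  · have h₁ : (p * (x * (p * q) ^ m)) * p = z ^ a := by
      rw [← hz, pow_succ', mul_assoc, mul_assoc, mul_pow_mul, ← mul_assoc, hq]
      simp only [mul_assoc]
    obtain ⟨z', hz'⟩ := exists_mul_eq_pow_of_mul_eq_pow h₁
    have hl : z'.length = z.length := hlz' (by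
      have h₂ := congrArg length h₁
      have h₃ := congrArg length hz'
      simp only [length_mul, length_pow] at h₂ h₃
      omega)
    obtain ⟨c, hc⟩ := exists_mul_eq_mul_of_prefix_pow
      (show (p * (p * x)) * (p * q) ^ m = z' ^ a by rw [← hz']; simp only [mul_assoc])
    have hpz' : Commute p z' := commute_of_periods
      (show p * (p * (p * x)) = (p * (p * x)) * q by rw [mul_assoc, mul_assoc, ← hq])
      hc (by simp only [length_mul]; omega)
    have h₂ : Commute p (x * (p * q) ^ m) :=
      commute_of_commute_mul_right (commute_of_commute_mul_right (hz' ▸ hpz'.pow_right a)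
        (Commute.refl p)) (Commute.refl p)
    have h₃ : x * (p * (q * p) ^ m) = x * (q * (p * q) ^ m) := by
      rw [← mul_pow_mul, ← mul_assoc, ← h₂.eq, ← mul_assoc, hq, mul_assoc]
    exact (eq_of_mul_eq_mul_of_length_eq (mul_left_cancel h₃) hlq.symm).1
  have hm : (m + 1) * (2 * p.length) = 2 * (m * p.length) + 2 * p.length := by ring
  have hm' : (m + 1) * (p.length + p.length) = 2 * (m * p.length) + 2 * p.length := by ring
  have hmp : 1 * p.length ≤ m * p.length := by gcongr; omega
  obtain rfl : a = 2 := by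
    by_contra hne
    have : 3 * z.length ≤ a * z.length := by gcongr; omega
    omega
  have hm₂ : 2 ≤ m := by
    by_contra hlt
    obtain rfl : m = 1 := by omega
    omega
  obtain ⟨g, rfl, hg⟩ := exists_eq_mul_of_mul_eq_mul_s5
    (show x * (q * p) ^ (m + 1) = z * z by rw [hz, sq]) (by omega)
  rw [length_mul] at *
  obtain ⟨d, hd, hgd⟩ := exists_eq_mul_of_mul_eq_mul_s5
    (show g * (x * g) = (q * p) * (q * p) ^ m by rw [← pow_succ', hg])
    (by rw [length_mul]; omega)
  have hld := congrArg length hd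
  simp only [length_mul] at hld
  obtain ⟨e, he, -⟩ := exists_eq_mul_of_mul_eq_mul_s5
    (show (d * (q * p)) * (q * p) ^ (m - 1) = x * g by
      rw [mul_assoc, ← pow_succ', Nat.sub_add_cancel (by omega), hgd]) (by
    simp only [length_mul]
    rcases hm₂.eq_or_lt with rfl | hm₃
    · omega
    · have : 3 * p.length ≤ m * p.length := by gcongr; omega
      omega)
  have h₁ : (p * d) * (q * (p * e)) = (d * q) * (p * (e * q)) := by
    have := hq
    rw [he] at this
    simpa only [mul_assoc] using this
  have h₂ := (eq_of_mul_eq_mul_of_length_eq h₁ (by simp only [length_mul]; omega)).2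
  exact (eq_of_mul_eq_mul_of_length_eq h₂ hlq).1.symm

theorem isImprimitiveWord_mul_comm {u v : FreeMonoid A} (h : IsImprimitiveWord (u * v)) :
    IsImprimitiveWord (v * u) := by
  obtain ⟨z, m, hm, hz⟩ := h
  obtain ⟨z', hz'⟩ := exists_mul_eq_pow_of_mul_eq_pow hz
  exact ⟨z', m, hm, hz'⟩

theorem commute_of_isImprimitiveWord_mul_pow_of_ne {x y : FreeMonoid A} {i j : ℕ} (hi : 1 ≤ i)
    (hj : 1 ≤ j) (hne : i ≠ j) (h₁ : IsImprimitiveWord (x * y ^ i))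
    (h₂ : IsImprimitiveWord (x * y ^ j)) : Commute x y := by
  wlog hij : i < j generalizing i j
  · exact this hj hi hne.symm h₂ h₁ (by omega)
  obtain ⟨k, rfl⟩ := Nat.exists_eq_add_of_le hij.le
  exact commute_of_isImprimitiveWord_mul_pow hi (by omega) h₁ h₂

theorem commute_of_isImprimitiveWord {x y : FreeMonoid A} {i j : ℕ} (hi : 1 ≤ i) (hj : 1 ≤ j)
    (hne : x * y ^ i ≠ x ^ j * y) (h₁ : IsImprimitiveWord (x * y ^ i))
    (h₂ : IsImprimitiveWord (x ^ j * y)) : Commute x y := by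
  rcases hj.eq_or_lt with rfl | hj₂
  · rw [pow_one] at h₂ hne
    refine commute_of_isImprimitiveWord_mul_pow_of_ne hi le_rfl ?_ h₁ (by rwa [pow_one])
    rintro rfl
    exact hne (by rw [pow_one])
  rcases hi.eq_or_lt with rfl | hi₂
  · rw [pow_one] at h₁
    exact (commute_of_isImprimitiveWord_mul_pow_of_ne le_rfl hj (by omega)
      (by rw [pow_one]; exact isImprimitiveWord_mul_comm h₁)
      (isImprimitiveWord_mul_comm h₂)).symm
  rcases le_total y.length x.length with hl | hl
  · exact commute_of_isImprimitiveWord_of_length_le hi₂ hj₂ hl h₁ h₂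
  · exact (commute_of_isImprimitiveWord_of_length_le hj₂ hi₂ hl
      (isImprimitiveWord_mul_comm h₂) (isImprimitiveWord_mul_comm h₁)).symm

end FreeMonoid

/-- If `x` and `y` do not commute, then the set `xy⁺ ∪ x⁺y` contains at most one
imprimitive word. -/
theorem stmt5 {A : Type*} (x y : FreeMonoid A) (h : x * y ≠ y * x)
    (w₁ w₂ : FreeMonoid A)
    (h₁ : (∃ n, 1 ≤ n ∧ w₁ = x * y ^ n) ∨ (∃ n, 1 ≤ n ∧ w₁ = x ^ n * y))
    (h₂ : (∃ n, 1 ≤ n ∧ w₂ = x * y ^ n) ∨ (∃ n, 1 ≤ n ∧ w₂ = x ^ n * y))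
    (hw₁ : IsImprimitiveWord w₁) (hw₂ : IsImprimitiveWord w₂) :
    w₁ = w₂ := by
  by_contra hne
  apply h
  rcases h₁ with ⟨i, hi, rfl⟩ | ⟨i, hi, rfl⟩ <;> rcases h₂ with ⟨j, hj, rfl⟩ | ⟨j, hj, rfl⟩
  · exact FreeMonoid.commute_of_isImprimitiveWord_mul_pow_of_ne hi hj
      (fun hij => hne (by rw [hij])) hw₁ hw₂
  · exact FreeMonoid.commute_of_isImprimitiveWord hi hj hne hw₁ hw₂
  · exact FreeMonoid.commute_of_isImprimitiveWord hj hi (Ne.symm hne) hw₂ hw₁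
  · exact (FreeMonoid.commute_of_isImprimitiveWord_mul_pow_of_ne hi hj
      (fun hij => hne (by rw [hij])) (FreeMonoid.isImprimitiveWord_mul_comm hw₁)
      (FreeMonoid.isImprimitiveWord_mul_comm hw₂)).symm
end
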